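/- Suppose {α_1, …, α_n, 1} are linearly independent over ℚ and let α_{k,1} be given by the Minkowski chain for α = (α_1, …, α_n). Then the form L_α is badly approximable if and only if the sequence |α_{k,1}| is bounded away from 0. -/

import Mathlib

/-- ξ(r) = p + α₁q₁ + ⋯ + αₙqₙ for r = (q₁, …, qₙ, p) ∈ ℤ^(n+1). -/
noncomputable def xi {n : ℕ} (α : Fin n → ℝ) (r : Fin (n + 1) → ℤ) : ℝ :=
  (r (Fin.last n) : ℝ) + ∑ i : Fin n, α i * (r (Fin.castSucc i) : ℝ)

/-- The real span of the rows of `A` preceding row `j`. -/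
def earlierRowSpan {n : ℕ} (A : Matrix (Fin (n + 1)) (Fin (n + 1)) ℤ) (j : Fin (n + 1)) :
    Submodule ℝ (Fin (n + 1) → ℝ) :=
  Submodule.span ℝ {x : Fin (n + 1) → ℝ | ∃ i : Fin (n + 1), i < j ∧ x = fun k => (A i k : ℝ)}

/-- `A` is the matrix produced by the Minkowski algorithm at stage `m`: each row has sup norm
at most `m`, is linearly independent of the previous rows, minimizes `|ξ|` among all integer
vectors with sup norm at most `m` that are linearly independent of the previous rows, and its
first nonzero entry is positive. -/
def IsMinkowskiMatrix {n : ℕ} (α : Fin n → ℝ) (m : ℕ)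
    (A : Matrix (Fin (n + 1)) (Fin (n + 1)) ℤ) : Prop :=
  ∀ j : Fin (n + 1),
    (∀ k, |A j k| ≤ (m : ℤ)) ∧
    (fun k => (A j k : ℝ)) ∉ earlierRowSpan A j ∧
    (∀ w : Fin (n + 1) → ℤ, (∀ k, |w k| ≤ (m : ℤ)) →
      ((fun k => (w k : ℝ)) ∉ earlierRowSpan A j) → |xi α (A j)| ≤ |xi α w|) ∧
    (∃ k₀ : Fin (n + 1), 0 < A j k₀ ∧ ∀ k < k₀, A j k = 0)

/-- `B` (indexed from 0, so `B 0 = B₁`) is the Minkowski chain of `α`: the subsequence of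
distinct matrices among the matrices `A m` produced by the Minkowski algorithm, starting
with `A 1`. -/
def IsMinkowskiChain {n : ℕ} (α : Fin n → ℝ)
    (B : ℕ → Matrix (Fin (n + 1)) (Fin (n + 1)) ℤ) : Prop :=
  ∃ (A : ℕ → Matrix (Fin (n + 1)) (Fin (n + 1)) ℤ) (idx : ℕ → ℕ),
    (∀ m, 1 ≤ m → IsMinkowskiMatrix α m (A m)) ∧
    StrictMono idx ∧ idx 0 = 1 ∧
    (∀ k, B k = A (idx k)) ∧
    (∀ k m, idx k ≤ m → m < idx (k + 1) → A m = A (idx k)) ∧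
    (∀ k, A (idx (k + 1)) ≠ A (idx k))
/-- The distance from a real number to the nearest integer. -/
noncomputable def distNearestInt (t : ℝ) : ℝ := |t - round t|

/-- The linear form L_α(q) = α₁q₁ + ⋯ + αₙqₙ. -/
noncomputable def Lform {n : ℕ} (α : Fin n → ℝ) (q : Fin n → ℤ) : ℝ :=
  ∑ i, α i * (q i : ℝ)

/-- The sup norm of an integer vector. -/
def intSupNorm {n : ℕ} (q : Fin n → ℤ) : ℕ := Finset.univ.sup fun i => (q i).natAbs

/-- The form L_α is badly approximable: there is `c > 0` with
`‖L_α(q)‖ ≥ c ‖q‖_∞^{-n}` for all nonzero integer vectors `q`. -/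
def BadlyApprox {n : ℕ} (α : Fin n → ℝ) : Prop :=
  ∃ c > (0 : ℝ), ∀ q : Fin n → ℤ, q ≠ 0 →
    c / (intSupNorm q : ℝ) ^ n ≤ distNearestInt (Lform α q)

/-- The form L_α is singular: for every `ε > 0` and all sufficiently large integers `Q`
there is a nonzero `q ∈ ℤⁿ` with `‖q‖_∞ ≤ Q` and `‖L_α(q)‖ ≤ ε Q^{-n}`. -/
def Singular {n : ℕ} (α : Fin n → ℝ) : Prop :=
  ∀ ε > (0 : ℝ), ∃ Q₀ : ℕ, ∀ Q : ℕ, Q₀ ≤ Q → ∃ q : Fin n → ℤ, q ≠ 0 ∧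
    (intSupNorm q : ℝ) ≤ (Q : ℝ) ∧ distNearestInt (Lform α q) ≤ ε / (Q : ℝ) ^ n

/-- Vectors each outside the span of the earlier ones are linearly independent. -/
theorem linearIndependent_of_notMem_span_earlier {K V : Type*} [DivisionRing K] [AddCommGroup V]
    [Module K V] {k : ℕ} (v : Fin k → V)
    (hv : ∀ j, v j ∉ Submodule.span K {x | ∃ i, i < j ∧ x = v i}) : LinearIndependent K v := by
  induction k with
  | zero => exact linearIndependent_empty_type
  | succ k ih =>
    rw [linearIndependent_finSucc']
    refine ⟨ih _ fun j hj => hv j.castSucc (Submodule.span_mono ?_ hj), fun h =>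
      hv (Fin.last k) (Submodule.span_mono ?_ h)⟩
    · rintro x ⟨i, hi, rfl⟩
      exact ⟨i.castSucc, Fin.castSucc_lt_castSucc_iff.2 hi, rfl⟩
    · rintro x ⟨i, rfl⟩
      exact ⟨i.castSucc, Fin.castSucc_lt_last i, rfl⟩

theorem abs_xi_le {n : ℕ} (α : Fin n → ℝ) (x : Fin (n + 1) → ℤ) {M : ℝ}
    (hx : ∀ k, |(x k : ℝ)| ≤ M) : |xi α x| ≤ (1 + ∑ i, |α i|) * M := by
  unfold xi
  calc _ ≤ |(x (Fin.last n) : ℝ)| + ∑ i, |α i * (x i.castSucc : ℝ)| :=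
        (abs_add_le _ _).trans (by gcongr; exact Finset.abs_sum_le_sum_abs _ _)
    _ ≤ M + ∑ i, |α i| * M := by
        gcongr with i
        · exact hx _
        · rw [abs_mul]; gcongr; exact hx _
    _ = _ := by rw [← Finset.sum_mul]; ring

/-- The last coordinate is controlled by the form and the other coordinates. -/
theorem abs_last_le {n : ℕ} (α : Fin n → ℝ) (x : Fin (n + 1) → ℤ) {M : ℝ}
    (hx : ∀ i : Fin n, |(x i.castSucc : ℝ)| ≤ M) :
    |(x (Fin.last n) : ℝ)| ≤ |xi α x| + (∑ i, |α i|) * M := by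
  have h : (x (Fin.last n) : ℝ) = xi α x - ∑ i, α i * (x i.castSucc : ℝ) := by
    unfold xi; ring
  rw [h]
  refine (abs_sub _ _).trans ?_
  gcongr
  rw [Finset.sum_mul]
  refine (Finset.abs_sum_le_sum_abs _ _).trans ?_
  gcongr with i
  rw [abs_mul]; gcongr; exact hx _

/-- Dirichlet's theorem for one linear form with prescribed box sides. -/
theorem exists_abs_xi_lt {n : ℕ} (α : Fin n → ℝ) (E : Fin n → ℕ) {N : ℕ} (hN : 0 < N)
    (h : N < ∏ i, (E i + 1)) :
    ∃ x : Fin (n + 1) → ℤ, x ≠ 0 ∧ (∀ i : Fin n, |(x i.castSucc : ℝ)| ≤ E i) ∧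
      |xi α x| < 1 / N := by
  have hN' : (0 : ℝ) < N := by exact_mod_cast hN
  let L : (Fin n → ℕ) → ℝ := fun q => ∑ i, α i * (q i : ℝ)
  let s : Finset (Fin n → ℕ) := Fintype.piFinset fun i => Finset.range (E i + 1)
  have hcard : (Finset.range N).card < s.card := by simpa [s] using h
  obtain ⟨q, hq, q', hq', hne, heq⟩ := Finset.exists_ne_map_eq_of_card_lt_of_maps_to hcard
    (f := fun q => ⌊Int.fract (L q) * N⌋₊) (by
      intro q _
      simp only [Finset.coe_range, Set.mem_Iio]
      rw [Nat.floor_lt (by positivity)]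
      nlinarith [Int.fract_lt_one (L q)])
  simp only [s, Fintype.mem_piFinset, Finset.mem_range] at hq hq'
  refine ⟨Fin.snoc (fun i => (q i : ℤ) - q' i) (⌊L q'⌋ - ⌊L q⌋), ?_, ?_, ?_⟩
  · intro h0
    apply hne
    funext i
    have := congrFun h0 i.castSucc
    simp only [Fin.snoc_castSucc, Pi.zero_apply] at this
    omega
  · intro i
    simp only [Fin.snoc_castSucc]
    have h1 := hq i
    have h2 := hq' i
    have : |(q i : ℤ) - q' i| ≤ E i := by rw [abs_le]; omega
    exact_mod_cast this
  · have hx : xi α (Fin.snoc (fun i => (q i : ℤ) - q' i) (⌊L q'⌋ - ⌊L q⌋) : Fin (n + 1) → ℤ)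
        = Int.fract (L q) - Int.fract (L q') := by
      simp only [xi, Fin.snoc_last, Fin.snoc_castSucc, Int.fract, L]
      push_cast
      simp only [mul_sub, Finset.sum_sub_distrib]
      ring
    rw [hx, lt_div_iff₀ hN', ← abs_of_pos hN', ← abs_mul, sub_mul, abs_lt]
    have e1 := Nat.floor_le (a := Int.fract (L q) * N) (by positivity)
    have e2 := Nat.lt_floor_add_one (Int.fract (L q) * N)
    have e3 := Nat.floor_le (a := Int.fract (L q') * N) (by positivity)
    have e4 := Nat.lt_floor_add_one (Int.fract (L q') * N)
    rw [heq] at e1 e2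
    constructor <;> linarith

/-- If the values of the form on nonzero integer points are bounded below in the badly
approximable way, then the integer points with small values do not lie in a hyperplane. -/
theorem exists_small_notMem_hyperplane {n : ℕ} (hn : 1 ≤ n) (α : Fin n → ℝ) {c : ℝ}
    (H : ∀ M : ℕ, 1 ≤ M → ∀ x : Fin (n + 1) → ℤ, x ≠ 0 →
      (∀ i : Fin n, |(x i.castSucc : ℝ)| ≤ M) → c / (M : ℝ) ^ n ≤ |xi α x|)
    {s t : ℕ} (hs : 1 ≤ s) (ht : 1 ≤ t) (hcs : (n : ℝ) ^ n < c * s ^ (n + 1))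
    (u : ℝ) (g : Fin n → ℝ) (hug : u = 0 → g ≠ 0) :
    ∃ x : Fin (n + 1) → ℤ, (∀ i : Fin n, |(x i.castSucc : ℝ)| ≤ (s : ℝ) ^ (n + 1) * t) ∧
      |xi α x| < 1 / (t : ℝ) ^ n ∧ u * xi α x + ∑ i, g i * (x i.castSucc : ℝ) ≠ 0 := by
  have hn' : (1 : ℝ) ≤ n := by exact_mod_cast hn
  have hs' : (1 : ℝ) ≤ s := by exact_mod_cast hs
  have ht' : (1 : ℝ) ≤ t := by exact_mod_cast ht
  have ht0 : (0 : ℝ) < t := by linarith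
  have hs0 : (0 : ℝ) < s := by linarith
  have hn0 : (0 : ℝ) < n := by linarith
  have hsp : (1 : ℝ) ≤ (s : ℝ) ^ (n + 1) := one_le_pow₀ hs'
  have : Nonempty (Fin n) := ⟨⟨0, hn⟩⟩
  obtain ⟨j, hj⟩ := Finite.exists_max fun i => |g i|
  rcases le_or_gt |u| (|g j| * (s * t) ^ (n + 1)) with hu | hu
  · have hgj : 0 < |g j| := by
      by_contra hcon
      have h0 : |g j| = 0 := le_antisymm (not_lt.1 hcon) (abs_nonneg _)
      rw [h0, zero_mul] at hu
      refine hug (abs_eq_zero.1 (le_antisymm hu (abs_nonneg _))) (funext fun i => ?_)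
      exact abs_eq_zero.1 (le_antisymm (h0 ▸ hj i) (abs_nonneg _))
    let E : Fin n → ℕ := Function.update (fun _ => t) j (s ^ (n + 1) * t)
    have hEpos : ∀ i, 0 < E i := by
      intro i
      by_cases hi : i = j
      · subst hi; simp only [E, Function.update_self]; positivity
      · simp only [E, Function.update_of_ne hi]; omega
    have hprod : ∏ i, E i = s ^ (n + 1) * t ^ n := by
      simp only [E]
      rw [Finset.prod_update_of_mem (Finset.mem_univ j), Finset.prod_const,
        ← Finset.erase_eq, Finset.card_erase_of_mem (Finset.mem_univ j), Finset.card_univ,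
        Fintype.card_fin, mul_assoc, ← pow_succ', Nat.sub_add_cancel hn]
    obtain ⟨x, hx0, hxE, hxi⟩ := exists_abs_xi_lt α E (N := s ^ (n + 1) * t ^ n) (by positivity)
      (by
        rw [← hprod]
        exact Finset.prod_lt_prod_of_nonempty (fun i _ => hEpos i) (fun i _ => Nat.lt_succ_self _)
          Finset.univ_nonempty)
    push_cast at hxi
    refine ⟨x, fun i => (hxE i).trans ?_, hxi.trans_le ?_, fun h0 => ?_⟩
    · by_cases hi : i = j
      · subst hi; simp [E]
      · simp only [E, Function.update_of_ne hi]
        nlinarith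
    · gcongr
      nlinarith [pow_pos ht0 n]
    have hxt : ∀ i, i ≠ j → |(x i.castSucc : ℝ)| ≤ t := by
      intro i hi
      simpa only [E, Function.update_of_ne hi] using hxE i
    have hxj : |(x j.castSucc : ℝ)| ≤ n * t := by
      refine le_of_mul_le_mul_left ?_ hgj
      rw [← Finset.add_sum_erase _ _ (Finset.mem_univ j)] at h0
      have h1 : g j * (x j.castSucc : ℝ) =
          -(u * xi α x + ∑ i ∈ Finset.univ.erase j, g i * (x i.castSucc : ℝ)) := by linarith
      rw [← abs_mul, h1, abs_neg]
      have h2 : |u * xi α x| ≤ |g j| * t := by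
        rw [abs_mul]
        calc |u| * |xi α x| ≤ (|g j| * (s * t) ^ (n + 1)) * (1 / (s ^ (n + 1) * t ^ n)) := by
              gcongr
          _ = |g j| * t := by rw [mul_pow, pow_succ (t : ℝ)]; field_simp
      have h3 : |∑ i ∈ Finset.univ.erase j, g i * (x i.castSucc : ℝ)| ≤
          (n - 1) * (|g j| * t) := by
        refine (Finset.abs_sum_le_sum_abs _ _).trans
          ((Finset.sum_le_card_nsmul _ _ (|g j| * t) ?_).trans ?_)
        · intro i hi
          rw [abs_mul]
          exact mul_le_mul (hj i) (hxt i (Finset.ne_of_mem_erase hi)) (abs_nonneg _) (abs_nonneg _)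
        · rw [Finset.card_erase_of_mem (Finset.mem_univ j), Finset.card_univ, Fintype.card_fin,
            nsmul_eq_mul, Nat.cast_sub hn, Nat.cast_one]
      linarith [abs_add_le (u * xi α x) (∑ i ∈ Finset.univ.erase j, g i * (x i.castSucc : ℝ))]
    have hH := H (n * t) (Nat.mul_pos hn ht) x hx0 (by
      intro i
      push_cast
      by_cases hi : i = j
      · subst hi; exact hxj
      · nlinarith [hxt i hi])
    push_cast at hH
    have h4 := hH.trans_lt hxi
    rw [mul_pow, div_lt_div_iff₀ (by positivity) (by positivity)] at h4
    have h5 : (c * s ^ (n + 1)) * (t : ℝ) ^ n < n ^ n * t ^ n := by linarith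
    exact absurd (lt_of_mul_lt_mul_right h5 (by positivity)) (not_lt.2 hcs.le)
  · obtain ⟨x, hx0, hxE, hxi⟩ := exists_abs_xi_lt α (fun _ => t) (N := t ^ n) (by positivity)
      (by simpa using Nat.pow_lt_pow_left (Nat.lt_succ_self t) (by omega))
    push_cast at hxi
    refine ⟨x, fun i => (hxE i).trans (by nlinarith), hxi, fun h0 => ?_⟩
    have hu0 : 0 < |u| := lt_of_le_of_lt (by positivity) hu
    have h1 : |u| * |xi α x| ≤ n * (|g j| * t) := by
      have : u * xi α x = -∑ i, g i * (x i.castSucc : ℝ) := by linarith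
      rw [← abs_mul, this, abs_neg]
      refine (Finset.abs_sum_le_sum_abs _ _).trans
        ((Finset.sum_le_card_nsmul _ _ (|g j| * t) ?_).trans (by simp))
      intro i _
      rw [abs_mul]
      exact mul_le_mul (hj i) (hxE i) (abs_nonneg _) (abs_nonneg _)
    have hH := H t ht x hx0 hxE
    have h2 : c / (t : ℝ) ^ n * (s * t) ^ (n + 1) ≤ n * t := by
      refine le_of_mul_le_mul_left ?_ hu0
      calc |u| * (c / (t : ℝ) ^ n * (s * t) ^ (n + 1))
          ≤ |u| * (|xi α x| * (s * t) ^ (n + 1)) := by gcongr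
        _ = (|u| * |xi α x|) * (s * t) ^ (n + 1) := by ring
        _ ≤ (n * (|g j| * t)) * (s * t) ^ (n + 1) := by gcongr
        _ = (|g j| * (s * t) ^ (n + 1)) * (n * t) := by ring
        _ ≤ |u| * (n * t) := by gcongr
    have h3 : c / (t : ℝ) ^ n * (s * t) ^ (n + 1) = (c * s ^ (n + 1)) * t := by
      rw [mul_pow, pow_succ (t : ℝ)]; field_simp
    rw [h3] at h2
    have h4 := le_of_mul_le_mul_right h2 ht0
    have h5 : (n : ℝ) ≤ n ^ n := le_self_pow₀ hn' (by omega)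
    linarith

theorem BadlyApprox.exists_le_abs_xi {n : ℕ} {α : Fin n → ℝ} (h : BadlyApprox α) :
    ∃ c > (0 : ℝ), ∀ M : ℕ, 1 ≤ M → ∀ x : Fin (n + 1) → ℤ, x ≠ 0 →
      (∀ i : Fin n, |(x i.castSucc : ℝ)| ≤ M) → c / (M : ℝ) ^ n ≤ |xi α x| := by
  obtain ⟨c, hc, h⟩ := h
  refine ⟨min c 1, by positivity, fun M hM x hx hxM => ?_⟩
  have hM' : (1 : ℝ) ≤ M := by exact_mod_cast hM
  by_cases hq : (fun i : Fin n => x i.castSucc) = 0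
  · have hq' : ∀ i : Fin n, x i.castSucc = 0 := fun i => congrFun hq i
    have hp : x (Fin.last n) ≠ 0 := by
      intro hp
      apply hx
      funext k
      refine Fin.lastCases hp (fun i => hq' i) k
    have : (1 : ℝ) ≤ |(x (Fin.last n) : ℝ)| := by exact_mod_cast Int.one_le_abs hp
    calc min c 1 / (M : ℝ) ^ n ≤ 1 / 1 := by
          gcongr
          · exact min_le_right _ _
          · exact one_le_pow₀ hM'
      _ ≤ |xi α x| := by simpa [xi, hq'] using this
  · have hpos : 0 < intSupNorm fun i : Fin n => x i.castSucc := by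
      obtain ⟨i, hi⟩ := Function.ne_iff.1 hq
      refine (Int.natAbs_pos.2 hi).trans_le ?_
      exact Finset.le_sup (f := fun i : Fin n => (x i.castSucc).natAbs) (Finset.mem_univ i)
    have hle : intSupNorm (fun i : Fin n => x i.castSucc) ≤ M := by
      refine Finset.sup_le fun i _ => ?_
      have h1 : |x i.castSucc| ≤ M := by exact_mod_cast hxM i
      rw [Int.abs_eq_natAbs] at h1
      exact_mod_cast h1
    have hpos' : (0 : ℝ) < (intSupNorm fun i : Fin n => x i.castSucc : ℕ) := by
      exact_mod_cast hpos
    calc min c 1 / (M : ℝ) ^ n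
        ≤ c / ((intSupNorm fun i : Fin n => x i.castSucc : ℕ) : ℝ) ^ n := by
          gcongr
          exact min_le_left _ _
      _ ≤ _ := h _ hq
      _ ≤ |xi α x| := by
          refine (round_le _ (-x (Fin.last n))).trans_eq ?_
          unfold xi Lform
          congr 1
          push_cast
          ring

namespace IsMinkowskiMatrix

variable {n m : ℕ} {α : Fin n → ℝ} {A : Matrix (Fin (n + 1)) (Fin (n + 1)) ℤ}

theorem abs_entry_le (hA : IsMinkowskiMatrix α m A) (j k : Fin (n + 1)) :
    |(A j k : ℝ)| ≤ m := by
  exact_mod_cast (hA j).1 k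

theorem row_ne_zero (hA : IsMinkowskiMatrix α m A) (j : Fin (n + 1)) : A j ≠ 0 := by
  intro h
  apply (hA j).2.1
  convert (earlierRowSpan A j).zero_mem
  simp [h]

theorem abs_xi_zero_le (hA : IsMinkowskiMatrix α m A) {w : Fin (n + 1) → ℤ} (hw : w ≠ 0)
    (hwm : ∀ k, |w k| ≤ (m : ℤ)) : |xi α (A 0)| ≤ |xi α w| := by
  refine (hA 0).2.2.1 w hwm fun h => hw ?_
  have h0 : earlierRowSpan A 0 = ⊥ := by simp [earlierRowSpan]
  rw [h0, Submodule.mem_bot] at h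
  funext k
  exact Int.cast_eq_zero.1 (congrFun h k)

theorem abs_xi_le_last (hA : IsMinkowskiMatrix α m A) (j : Fin (n + 1)) :
    |xi α (A j)| ≤ |xi α (A (Fin.last n))| := by
  refine (hA j).2.2.1 _ (hA _).1 fun h => (hA (Fin.last n)).2.1 (Submodule.span_mono ?_ h)
  rintro x ⟨i, hi, rfl⟩
  exact ⟨i, hi.trans_le (Fin.le_last j), rfl⟩

theorem one_le_abs_det (hA : IsMinkowskiMatrix α m A) :
    1 ≤ |(A.map (fun z => (z : ℝ))).det| := by
  have hli : LinearIndependent ℝ (A.map (fun z => (z : ℝ))).row :=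
    linearIndependent_of_notMem_span_earlier _ fun j => (hA j).2.1
  rw [Matrix.linearIndependent_rows_iff_isUnit, Matrix.isUnit_iff_isUnit_det,
    isUnit_iff_ne_zero] at hli
  have hdet : (A.map (fun z => (z : ℝ))).det = (A.det : ℝ) :=
    ((Int.castRingHom ℝ).map_det A).symm
  rw [hdet] at hli ⊢
  exact_mod_cast Int.one_le_abs (by exact_mod_cast hli)

/-- The determinant gives a lower bound for the value of the form on the last row. -/
theorem one_le_mul_abs_xi_last (hA : IsMinkowskiMatrix α m A) :
    1 ≤ ((n + 1).factorial : ℝ) * ((m : ℝ) ^ n * |xi α (A (Fin.last n))|) := by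
  refine hA.one_le_abs_det.trans ?_
  set R := A.map (fun z => (z : ℝ)) with hR
  have hcol : R.updateCol (Fin.last n) (fun k => xi α (A k)) =
      R.updateCol (Fin.last n) (fun k => ∑ i, ((Fin.snoc α 1 : Fin (n + 1) → ℝ) i) • R k i) := by
    congr 1
    funext k
    rw [Fin.sum_univ_castSucc]
    simp [xi, hR, add_comm]
  have hdet : (R.updateCol (Fin.last n) (fun k => xi α (A k))).det = R.det := by
    rw [hcol, Matrix.det_updateCol_sum]
    simp
  rw [← hdet, Matrix.det_apply']
  refine (Finset.abs_sum_le_sum_abs _ _).trans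
    ((Finset.sum_le_card_nsmul _ _ ((m : ℝ) ^ n * |xi α (A (Fin.last n))|) ?_).trans_eq ?_)
  · intro σ _
    rw [abs_mul, Finset.abs_prod, Fin.prod_univ_castSucc]
    have hsign : |((Equiv.Perm.sign σ : ℤ) : ℝ)| = 1 := by
      rcases Int.units_eq_one_or (Equiv.Perm.sign σ) with h | h <;> simp [h]
    rw [hsign, one_mul, Matrix.updateCol_self]
    refine mul_le_mul ?_ (hA.abs_xi_le_last _) (abs_nonneg _) (by positivity)
    · refine (Finset.prod_le_prod (fun _ _ => abs_nonneg _) (g := fun _ => (m : ℝ)) ?_).trans_eq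
        (by simp)
      intro i _
      rw [Matrix.updateCol_ne (Fin.castSucc_lt_last i).ne]
      exact hA.abs_entry_le _ _
  · rw [Finset.card_univ, Fintype.card_perm, Fintype.card_fin, nsmul_eq_mul]

/-- A lower bound of badly approximable type forces the value on the last row to be small. -/
theorem exists_abs_xi_last_le (hn : 1 ≤ n) {c : ℝ} (hc : 0 < c)
    (H : ∀ M : ℕ, 1 ≤ M → ∀ x : Fin (n + 1) → ℤ, x ≠ 0 →
      (∀ i : Fin n, |(x i.castSucc : ℝ)| ≤ M) → c / (M : ℝ) ^ n ≤ |xi α x|) :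
    ∃ C > (0 : ℝ), ∀ m A, 1 ≤ m → IsMinkowskiMatrix α m A →
      |xi α (A (Fin.last n))| ≤ C / (m : ℝ) ^ n := by
  obtain ⟨s₀, hs₀⟩ := exists_nat_gt ((n : ℝ) ^ n / c)
  obtain ⟨a, ha⟩ := exists_nat_ge (∑ i, |α i|)
  set s := s₀ + 1 with hs
  have hs1 : (1 : ℝ) ≤ s := by simp [hs]
  have hcs : (n : ℝ) ^ n < c * s ^ (n + 1) := by
    rw [div_lt_iff₀ hc] at hs₀
    have h1 : (s : ℝ) ≤ s ^ (n + 1) := le_self_pow₀ hs1 (by omega)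
    have h2 : (s₀ : ℝ) ≤ s := by simp [hs]
    nlinarith
  set D := (a + 1) * s ^ (n + 1) with hD
  have hDpos : 0 < D := by positivity
  have hD0 : (0 : ℝ) < D := by exact_mod_cast hDpos
  refine ⟨(1 + a) * D * D ^ n + (2 * D) ^ n, by positivity, fun m A hm hA => ?_⟩
  have hm0 : (0 : ℝ) < m := by exact_mod_cast hm
  rw [le_div_iff₀ (by positivity)]
  rcases lt_or_ge m D with hmD | hmD
  · have hmD' : (m : ℝ) ≤ D := by exact_mod_cast hmD.le
    have h1 := abs_xi_le α (A (Fin.last n)) (hA.abs_entry_le (Fin.last n))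
    calc |xi α (A (Fin.last n))| * (m : ℝ) ^ n ≤ ((1 + a) * D) * D ^ n := by
          gcongr
          exact h1.trans (by gcongr)
      _ ≤ _ := by linarith [pow_pos (mul_pos two_pos hD0) n]
  · set t := m / D with ht
    have ht1 : 1 ≤ t := (Nat.one_le_div_iff hDpos).2 hmD
    have ht1' : (1 : ℝ) ≤ t := by exact_mod_cast ht1
    have htm : (D : ℝ) * t ≤ m := by exact_mod_cast Nat.mul_div_le m D
    have hmt : (m : ℝ) ≤ 2 * D * t := by
      have : m < D * (t + 1) := Nat.lt_mul_div_succ m hDpos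
      have : (m : ℝ) < D * (t + 1) := by exact_mod_cast this
      nlinarith
    obtain ⟨f, hf0, hf⟩ := Submodule.exists_le_ker_of_notMem (hA (Fin.last n)).2.1
    let φ : Fin (n + 1) → ℝ := fun k => f (Pi.single k 1)
    have hfφ : ∀ y, f y = ∑ k, y k * φ k := by
      intro y
      rw [LinearMap.pi_apply_eq_sum_univ f y]
      refine Finset.sum_congr rfl fun k _ => ?_
      simp only [smul_eq_mul, φ]
      congr 2
      funext l
      simp [Pi.single_apply, eq_comm]
    obtain ⟨x, hxq, hxi, hx⟩ := exists_small_notMem_hyperplane hn α H (s := s) (by omega) ht1 hcs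
      (φ (Fin.last n)) (fun i => φ i.castSucc - φ (Fin.last n) * α i) (by
        intro hu hg
        apply hf0
        rw [hfφ, Fin.sum_univ_castSucc, hu]
        have : ∀ i : Fin n, φ i.castSucc = 0 := fun i => by simpa [hu] using congrFun hg i
        simp [this])
    have hfx : f (fun k => (x k : ℝ)) = φ (Fin.last n) * xi α x +
        ∑ i : Fin n, (φ i.castSucc - φ (Fin.last n) * α i) * (x i.castSucc : ℝ) := by
      rw [hfφ, Fin.sum_univ_castSucc]
      simp only [xi, sub_mul, Finset.sum_sub_distrib, mul_add, Finset.mul_sum]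
      simp only [mul_assoc, mul_comm (φ _)]
      ring_nf
    rw [← hfx] at hx
    have htn : (1 : ℝ) ≤ (t : ℝ) ^ n := one_le_pow₀ ht1'
    have hxm : ∀ k, |x k| ≤ (m : ℤ) := by
      have hsp : (1 : ℝ) ≤ (s : ℝ) ^ (n + 1) := one_le_pow₀ hs1
      have hDr : (D : ℝ) * t = (a + 1) * (s ^ (n + 1) * t) := by rw [hD]; push_cast; ring
      have hst : (1 : ℝ) ≤ s ^ (n + 1) * t := one_le_mul_of_one_le_of_one_le hsp ht1'
      have ha0 : (0 : ℝ) ≤ a := Nat.cast_nonneg a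
      intro k
      suffices |(x k : ℝ)| ≤ m by exact_mod_cast this
      refine Fin.lastCases ?_ (fun i => ?_) k
      · have h1 := abs_last_le α x hxq
        have h2 : 1 / (t : ℝ) ^ n ≤ 1 := by
          rw [div_le_one (by positivity)]; exact htn
        have h3 : (∑ i, |α i|) * ((s : ℝ) ^ (n + 1) * t) ≤ a * (s ^ (n + 1) * t) := by gcongr
        linarith
      · have h1 := hxq i
        nlinarith
    have hmin := (hA (Fin.last n)).2.2.1 x hxm fun hmem => hx (hf hmem)
    calc |xi α (A (Fin.last n))| * (m : ℝ) ^ n ≤ (1 / (t : ℝ) ^ n) * (2 * D * t) ^ n := by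
          gcongr
          exact hmin.trans hxi.le
      _ = (2 * D) ^ n := by rw [mul_pow (2 * (D : ℝ))]; field_simp
      _ ≤ _ := by
          have : 0 ≤ (1 + a) * D * (D : ℝ) ^ n := by positivity
          linarith

end IsMinkowskiMatrix

/-- A uniform lower bound on the first row of all Minkowski matrices gives bad
approximability. -/
theorem badlyApprox_of_le_abs_xi_zero {n : ℕ} {α : Fin n → ℝ} {c : ℝ} (hc : 0 < c)
    (h : ∀ m : ℕ, 1 ≤ m → ∃ A, IsMinkowskiMatrix α m A ∧ c / (m : ℝ) ^ n ≤ |xi α (A 0)|) :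
    BadlyApprox α := by
  obtain ⟨a, ha⟩ := exists_nat_ge (∑ i, |α i|)
  refine ⟨c / (a + 1) ^ n, by positivity, fun q hq => ?_⟩
  have hqle : ∀ i, (q i).natAbs ≤ intSupNorm q := fun i =>
    Finset.le_sup (f := fun i => (q i).natAbs) (Finset.mem_univ i)
  set M := intSupNorm q with hM
  have hMpos : 0 < M := by
    obtain ⟨i, hi⟩ := Function.ne_iff.1 hq
    exact (Int.natAbs_pos.2 hi).trans_le (hqle i)
  have hM1 : (1 : ℝ) ≤ M := by exact_mod_cast hMpos
  set w : Fin (n + 1) → ℤ := Fin.snoc q (-round (Lform α q)) with hw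
  have hxi : |xi α w| = distNearestInt (Lform α q) := by
    simp only [xi, hw, distNearestInt, Fin.snoc_last, Fin.snoc_castSucc, Lform]
    congr 1
    push_cast
    ring
  have hwq : ∀ i : Fin n, |(w i.castSucc : ℝ)| ≤ M := by
    intro i
    have h1 := hqle i
    have : |q i| ≤ M := by rw [Int.abs_eq_natAbs]; exact_mod_cast h1
    simp only [hw, Fin.snoc_castSucc]
    exact_mod_cast this
  have hw0 : w ≠ 0 := by
    intro h0
    apply hq
    funext i
    simpa [hw] using congrFun h0 i.castSucc
  have ha0 : (0 : ℝ) ≤ a := Nat.cast_nonneg a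
  obtain ⟨A, hA, hcA⟩ := h ((a + 1) * M) (Nat.mul_pos a.succ_pos hMpos)
  have hwm : ∀ k, |w k| ≤ (((a + 1) * M : ℕ) : ℤ) := by
    intro k
    suffices |(w k : ℝ)| ≤ ((a + 1) * M : ℕ) by exact_mod_cast this
    push_cast
    refine Fin.lastCases ?_ (fun i => ?_) k
    · have h1 := abs_last_le α w hwq
      have h2 : |xi α w| ≤ 1 / 2 := hxi ▸ abs_sub_round _
      have h3 : (∑ i, |α i|) * (M : ℝ) ≤ a * M := by gcongr
      linarith
    · nlinarith [hwq i]
  rw [← hxi, div_div, ← mul_pow]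
  push_cast at hcA
  exact hcA.trans (hA.abs_xi_zero_le hw0 hwm)

theorem IsMinkowskiChain.exists_isMinkowskiMatrix {n : ℕ} {α : Fin n → ℝ}
    {B : ℕ → Matrix (Fin (n + 1)) (Fin (n + 1)) ℤ} (hB : IsMinkowskiChain α B) :
    (∀ k, ∃ m, 1 ≤ m ∧ IsMinkowskiMatrix α m (B k)) ∧
      ∀ m, 1 ≤ m → ∃ k, IsMinkowskiMatrix α m (B k) := by
  obtain ⟨A, idx, hA, hmono, h0, hBA, hconst, -⟩ := hB
  constructor
  · intro k
    have h1 : 1 ≤ idx k := h0 ▸ hmono.monotone (Nat.zero_le k)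
    exact ⟨idx k, h1, hBA k ▸ hA _ h1⟩
  · intro m hm
    have hex : ∃ k, m < idx k := ⟨m + 1, (Nat.lt_succ_self m).trans_le hmono.le_apply⟩
    classical
    obtain ⟨k, hk⟩ : ∃ k, Nat.find hex = k + 1 := Nat.exists_eq_succ_of_ne_zero (by
      intro hz
      have := Nat.find_spec hex
      rw [hz, h0] at this
      omega)
    have hlt : m < idx (k + 1) := hk ▸ Nat.find_spec hex
    have hle : idx k ≤ m := not_lt.1 (Nat.find_min hex (by omega))
    exact ⟨k, by rw [hBA, ← hconst k m hle hlt]; exact hA m hm⟩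

/-- Suppose `{α₁, …, αₙ, 1}` are linearly independent over `ℚ` and `B` is the Minkowski
chain for `α`, with `α_{k,1} = β_{k,1}/β_{k,ℓ}` where `β_{k,j} = ξ(j-th row of B_k)`.
Then the form `L_α` is badly approximable if and only if `|α_{k,1}|` is bounded away
from `0`. -/
theorem badlyApprox_iff_bounded_away {n : ℕ} (hn : 1 ≤ n) (α : Fin n → ℝ)
    (hind : LinearIndependent ℚ (Fin.snoc α 1 : Fin (n + 1) → ℝ))
    (B : ℕ → Matrix (Fin (n + 1)) (Fin (n + 1)) ℤ)
    (hB : IsMinkowskiChain α B) :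
    BadlyApprox α ↔
      ∃ c > (0 : ℝ), ∀ k : ℕ, c ≤ |xi α (B k 0) / xi α (B k (Fin.last n))| := by
  obtain ⟨hBm, hmB⟩ := hB.exists_isMinkowskiMatrix
  constructor
  · intro h
    obtain ⟨c, hc, H⟩ := h.exists_le_abs_xi
    obtain ⟨C, hC, hlast⟩ := IsMinkowskiMatrix.exists_abs_xi_last_le hn hc H
    refine ⟨c / C, by positivity, fun k => ?_⟩
    obtain ⟨m, hm, hA⟩ := hBm k
    have hm0 : (0 : ℝ) < m := by exact_mod_cast hm
    have h1 := H m hm _ (hA.row_ne_zero 0) fun i => hA.abs_entry_le 0 _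
    have h2 := hlast m _ hm hA
    have h3 : 0 < |xi α (B k (Fin.last n))| :=
      (div_pos hc (pow_pos hm0 n)).trans_le (h1.trans (hA.abs_xi_le_last 0))
    rw [abs_div, le_div_iff₀ h3]
    calc c / C * |xi α (B k (Fin.last n))| ≤ c / C * (C / (m : ℝ) ^ n) := by gcongr
      _ = c / (m : ℝ) ^ n := by field_simp
      _ ≤ _ := h1
  · rintro ⟨c, hc, h⟩
    refine badlyApprox_of_le_abs_xi_zero (c := c / (n + 1).factorial) (by positivity)
      fun m hm => ?_
    obtain ⟨k, hA⟩ := hmB m hm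
    refine ⟨B k, hA, ?_⟩
    have hm0 : (0 : ℝ) < m := by exact_mod_cast hm
    have h1 := hA.one_le_mul_abs_xi_last
    have h2 := h k
    have h3 : 0 < |xi α (B k (Fin.last n))| := by
      by_contra hcon
      have h0 : |xi α (B k (Fin.last n))| = 0 := le_antisymm (not_lt.1 hcon) (abs_nonneg _)
      rw [h0] at h1
      norm_num at h1
    rw [abs_div, le_div_iff₀ h3] at h2
    refine le_trans ?_ h2
    rw [div_div, div_le_iff₀ (by positivity)]
    calc c = c * 1 := (mul_one c).symm
      _ ≤ c * (((n + 1).factorial : ℝ) * ((m : ℝ) ^ n * |xi α (B k (Fin.last n))|)) := by gcongr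
      _ = _ := by ring
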